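/- Let K₀ = max{1, 2(9+ε)/r}. For every δ > 0 there exists N such that for all n ≥ N and every pair of distinct vertices v₁, v₂ of 𝔾(n,p₂,p₃), the probability that the propagation component of the pair satisfies |C_{v₁,v₂}| ≥ K₀·ln n is at most n^{I_{ε,r}+δ}. -/

import Mathlib

open MeasureTheory Real Filter

/-- Bernoulli-type measure on `Bool` with success probability `p`. -/
noncomputable def bern (p : ℝ) : Measure Bool :=
  (ENNReal.ofReal p) • Measure.dirac true + (ENNReal.ofReal (1 - p)) • Measure.dirac false

instance bern_finite (p : ℝ) : IsFiniteMeasure (bern p) := by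
  constructor
  simp only [bern, Measure.coe_add, Measure.coe_smul, Pi.add_apply, Pi.smul_apply,
    smul_eq_mul]
  finiteness

/-- Index type of potential edges: subsets of size 2 or 3. -/
abbrev EdgeIdx (n : ℕ) := {e : Finset (Fin n) // e.card = 2 ∨ e.card = 3}

/-- The law of the random hypergraph `𝔾(n, p₂, p₃)` with `p₂ = (1-ε)/n` and
`p₃ = r/(n ln n)`: the product of Bernoulli measures over all 2- and 3-subsets. -/
noncomputable def hypMeasure (n : ℕ) (ε r : ℝ) : Measure (EdgeIdx n → Bool) :=
  Measure.pi fun e =>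
    bern (if e.1.card = 2 then (1 - ε) / n else r / (n * Real.log n))

/-- `e` is an edge of the configuration `ω`. -/
def IsEdge {n : ℕ} (ω : EdgeIdx n → Bool) (e : Finset (Fin n)) : Prop :=
  ∃ h : e.card = 2 ∨ e.card = 3, ω ⟨e, h⟩ = true

/-- The constant `I_{ε,r} = -(1/r)(ε - ε²/2 + (1-ε)ln(1-ε))`. -/
noncomputable def Ier (ε r : ℝ) : ℝ :=
  -(1 / r) * (ε - ε ^ 2 / 2 + (1 - ε) * Real.log (1 - ε))

/-- The constant `K₀ = max {1, 2(9+ε)/r}`. -/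
noncomputable def K0 (ε r : ℝ) : ℝ := max 1 (2 * (9 + ε) / r)

/-- `f 0, …, f (k-1)` is a propagation sequence from the vertex set `S`:
every `f l` is an edge and meets `S ∪ f 0 ∪ ⋯ ∪ f (l-1)` in all but exactly
one vertex. -/
def IsPropSeqFrom {n : ℕ} (ω : EdgeIdx n → Bool) (S : Finset (Fin n))
    (k : ℕ) (f : ℕ → Finset (Fin n)) : Prop :=
  (∀ i < k, IsEdge ω (f i)) ∧
  ∀ l < k, (f l ∩ (S ∪ (Finset.range l).biUnion f)).card = (f l).card - 1

/-- The propagation component of the vertex set `S`: the union of `S` with all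
edges occurring in propagation sequences from `S`. -/
def propComponent {n : ℕ} (ω : EdgeIdx n → Bool) (S : Finset (Fin n)) : Set (Fin n) :=
  ↑S ∪ {x | ∃ k f, IsPropSeqFrom ω S k f ∧ ∃ i < k, x ∈ f i}

section Exploration

variable {n : ℕ}

/-- The potential edges with at least two vertices outside `P`: exactly those not yet examined
once all vertices of `P` have been processed. -/
def edgesBeyond (P : Finset (Fin n)) : Finset (EdgeIdx n) :=
  Finset.univ.filter fun e => 1 < (e.1 \ P).card

/-- Every vertex set containing `P ∪ A` and closed under propagation along the edges beyond `P`
has at least `M` vertices. -/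
def Survives (M : ℕ) (P A : Finset (Fin n)) (ω : EdgeIdx n → Bool) : Prop :=
  ∀ T : Finset (Fin n), P ∪ A ⊆ T →
    (∀ e ∈ edgesBeyond P, ω e = true → (e.1 \ T).card ≤ 1 → e.1 ⊆ T) → M ≤ T.card

/-- The potential edges examined when the vertex `a` is processed after those of `P`. -/
def newEdges (P : Finset (Fin n)) (a : Fin n) : Finset (EdgeIdx n) :=
  edgesBeyond P \ edgesBeyond (insert a P)

/-- The active vertices after processing `a`. -/
def nextActive (P A : Finset (Fin n)) (a : Fin n) (ω : EdgeIdx n → Bool) : Finset (Fin n) :=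
  (A ∪ ((newEdges P a).filter fun e => ω e = true).biUnion fun e => e.1) \ insert a P

lemma mem_edgesBeyond {P : Finset (Fin n)} {e : EdgeIdx n} :
    e ∈ edgesBeyond P ↔ 1 < (e.1 \ P).card := by
  simp [edgesBeyond]

lemma mem_newEdges {P : Finset (Fin n)} {a : Fin n} {e : EdgeIdx n} :
    e ∈ newEdges P a ↔ 1 < (e.1 \ P).card ∧ (e.1 \ insert a P).card ≤ 1 := by
  simp [newEdges, mem_edgesBeyond]

lemma edgesBeyond_insert_subset (P : Finset (Fin n)) (a : Fin n) :
    edgesBeyond (insert a P) ⊆ edgesBeyond P := by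
  intro e he
  rw [mem_edgesBeyond] at he ⊢
  exact he.trans_le
    (Finset.card_le_card (Finset.sdiff_subset_sdiff le_rfl (Finset.subset_insert a P)))

lemma nextActive_congr {P A : Finset (Fin n)} {a : Fin n} {ω ω' : EdgeIdx n → Bool}
    (h : ∀ e ∈ newEdges P a, ω e = ω' e) : nextActive P A a ω = nextActive P A a ω' := by
  unfold nextActive
  rw [Finset.filter_congr fun e he => by rw [h e he]]

lemma Survives.step {M : ℕ} {P A : Finset (Fin n)} {a : Fin n} {ω : EdgeIdx n → Bool}
    (h : Survives M P A ω) : Survives M (insert a P) (nextActive P A a ω) ω := by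
  intro T hT hclosed
  have hA : A ∪ (((newEdges P a).filter fun e => ω e = true).biUnion fun e => e.1) ⊆ T := by
    intro x hx
    apply hT
    by_cases hxP : x ∈ insert a P
    · exact Finset.mem_union_left _ hxP
    · exact Finset.mem_union_right _ (Finset.mem_sdiff.2 ⟨hx, hxP⟩)
  refine h T (Finset.union_subset ?_ (Finset.subset_union_left.trans hA)) fun e he hω hcard => ?_
  · exact (Finset.subset_insert a P).trans (Finset.subset_union_left.trans hT)
  · by_cases he' : e ∈ edgesBeyond (insert a P)
    · exact hclosed e he' hω hcard
    · have hmem : e ∈ (newEdges P a).filter fun e => ω e = true :=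
        Finset.mem_filter.2 ⟨Finset.mem_sdiff.2 ⟨he, he'⟩, hω⟩
      exact (Finset.subset_biUnion_of_mem (fun e : EdgeIdx n => e.1) hmem).trans
        (Finset.subset_union_right.trans hA)

lemma not_survives_empty {M : ℕ} {P : Finset (Fin n)} (hP : P.card < M) (ω : EdgeIdx n → Bool) :
    ¬ Survives M P ∅ ω := fun h => by
  refine hP.not_ge (h P (by simp) fun e he _ hcard => ?_)
  rw [mem_edgesBeyond] at he
  omega

lemma card_nextActive_le {P A : Finset (Fin n)} {a : Fin n} (ha : a ∈ A) (ω : EdgeIdx n → Bool) :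
    (nextActive P A a ω).card ≤
      A.card - 1 + ((newEdges P a).filter fun e => ω e = true).card := by
  have hsub : nextActive P A a ω ⊆ A.erase a ∪
      ((newEdges P a).filter fun e => ω e = true).biUnion fun e => e.1 \ insert a P := by
    intro x hx
    simp only [nextActive, Finset.mem_sdiff, Finset.mem_union, Finset.mem_biUnion,
      Finset.mem_insert, Finset.mem_erase, not_or] at hx ⊢
    obtain ⟨hx | ⟨e, he, hxe⟩, hxa, hxP⟩ := hx
    · exact Or.inl ⟨hxa, hx⟩
    · exact Or.inr ⟨e, he, hxe, hxa, hxP⟩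
  refine (Finset.card_le_card hsub).trans ((Finset.card_union_le _ _).trans ?_)
  rw [Finset.card_erase_of_mem ha]
  gcongr
  refine (Finset.card_biUnion_le_card_mul _ _ 1 fun e he => ?_).trans (mul_one _).le
  exact (mem_newEdges.1 (Finset.mem_filter.1 he).1).2

lemma mem_of_mem_newEdges {P : Finset (Fin n)} {a : Fin n} {e : EdgeIdx n}
    (he : e ∈ newEdges P a) : a ∈ e.1 := by
  by_contra hae
  rw [mem_newEdges, Finset.sdiff_insert_of_notMem hae] at he
  omega

lemma card_newEdges_two_le (P : Finset (Fin n)) (a : Fin n) :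
    ((newEdges P a).filter fun e => e.1.card = 2).card ≤ n := by
  have hsub : (((newEdges P a).filter fun e => e.1.card = 2).map (Function.Embedding.subtype _)) ⊆
      Finset.univ.image fun u : Fin n => ({a, u} : Finset (Fin n)) := by
    intro s hs
    simp only [Finset.mem_map, Finset.mem_filter] at hs
    obtain ⟨e, ⟨he, hcard⟩, rfl⟩ := hs
    have ha := mem_of_mem_newEdges he
    have h1 : (e.1.erase a).card = 1 := by rw [Finset.card_erase_of_mem ha, hcard]
    obtain ⟨u, hu⟩ := Finset.card_eq_one.1 h1
    refine Finset.mem_image.2 ⟨u, Finset.mem_univ _, ?_⟩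
    rw [← hu, Finset.insert_erase ha]
    rfl
  have := (Finset.card_le_card hsub).trans Finset.card_image_le
  simpa using this

lemma card_newEdges_three_le (P : Finset (Fin n)) (a : Fin n) :
    ((newEdges P a).filter fun e => ¬ e.1.card = 2).card ≤ P.card * n := by
  have hsub : (((newEdges P a).filter fun e => ¬ e.1.card = 2).map
      (Function.Embedding.subtype _)) ⊆
      (P ×ˢ Finset.univ).image fun q : Fin n × Fin n => ({a, q.1, q.2} : Finset (Fin n)) := by
    intro s hs
    simp only [Finset.mem_map, Finset.mem_filter] at hs
    obtain ⟨e, ⟨he, hcard⟩, rfl⟩ := hs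
    have ha := mem_of_mem_newEdges he
    have hcard3 : e.1.card = 3 := e.2.resolve_left hcard
    have h1 : (e.1.erase a).card = 2 := by rw [Finset.card_erase_of_mem ha, hcard3]
    obtain ⟨p, hp, hpP⟩ : ∃ p ∈ e.1.erase a, p ∈ P := by
      by_contra! hcon
      have h2 : e.1 \ insert a P = e.1.erase a := by
        ext x
        have := hcon x
        simp only [Finset.mem_sdiff, Finset.mem_insert, Finset.mem_erase] at this ⊢
        tauto
      have := (mem_newEdges.1 he).2
      rw [h2] at this
      omega
    have h3 : ((e.1.erase a).erase p).card = 1 := by rw [Finset.card_erase_of_mem hp, h1]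
    obtain ⟨u, hu⟩ := Finset.card_eq_one.1 h3
    refine Finset.mem_image.2 ⟨(p, u), by simp [hpP], ?_⟩
    dsimp only
    rw [← hu, Finset.insert_erase hp, Finset.insert_erase ha]
    rfl
  have := (Finset.card_le_card hsub).trans Finset.card_image_le
  simpa using this

lemma sum_newEdges_le (P : Finset (Fin n)) (a : Fin n) {p₂ p₃ : ℝ}
    (h₂ : 0 ≤ p₂) (h₃ : 0 ≤ p₃) :
    ∑ e ∈ newEdges P a, (if e.1.card = 2 then p₂ else p₃) ≤ n * p₂ + P.card * (n * p₃) := by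
  rw [Finset.sum_ite, Finset.sum_const, Finset.sum_const, nsmul_eq_mul, nsmul_eq_mul, ← mul_assoc]
  gcongr
  · exact_mod_cast card_newEdges_two_le P a
  · exact_mod_cast card_newEdges_three_le P a

lemma propComponent_subset {ω : EdgeIdx n → Bool} {S T : Finset (Fin n)} (hST : S ⊆ T)
    (hclosed : ∀ e : EdgeIdx n, ω e = true → (e.1 \ T).card ≤ 1 → e.1 ⊆ T) :
    propComponent ω S ⊆ ↑T := by
  rintro x (hx | ⟨k, f, ⟨hedge, hprop⟩, i, hi, hx⟩)
  · exact hST hx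
  · suffices ∀ l, l < k → f l ⊆ T from this i hi hx
    intro l
    induction l using Nat.strong_induction_on with
    | _ l ih =>
      intro hl
      obtain ⟨hcard, hω⟩ := hedge l hl
      refine hclosed ⟨f l, hcard⟩ hω ?_
      have hsub : S ∪ (Finset.range l).biUnion f ⊆ T :=
        Finset.union_subset hST (Finset.biUnion_subset.2 fun j hj =>
          ih j (Finset.mem_range.1 hj) ((Finset.mem_range.1 hj).trans hl))
      have h1 := Finset.card_le_card (Finset.sdiff_subset_sdiff (le_refl (f l)) hsub)
      have h2 := Finset.card_sdiff_add_card_inter (f l) (S ∪ (Finset.range l).biUnion f)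
      have h3 := hprop l hl
      have h4 : (f l \ T).card ≤ 1 := by omega
      exact h4

lemma survives_of_le_ncard_propComponent {ω : EdgeIdx n → Bool} {S : Finset (Fin n)} {M : ℕ}
    (h : M ≤ (propComponent ω S).ncard) : Survives M ∅ S ω := by
  intro T hT hclosed
  have hsub : propComponent ω S ⊆ ↑T := by
    refine propComponent_subset (by simpa using hT) fun e he hcard => hclosed e ?_ he hcard
    rw [mem_edgesBeyond, Finset.sdiff_empty]
    have := e.2
    omega
  calc M ≤ (propComponent ω S).ncard := h
    _ ≤ (T : Set (Fin n)).ncard := Set.ncard_le_ncard hsub T.finite_toSet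
    _ = T.card := Set.ncard_coe_finset T

end Exploration

section Probability

lemma isProbabilityMeasure_bern {p : ℝ} (h0 : 0 ≤ p) (h1 : p ≤ 1) :
    IsProbabilityMeasure (bern p) := by
  constructor
  simp only [bern, Measure.coe_add, Measure.coe_smul, Pi.add_apply, Pi.smul_apply, smul_eq_mul,
    measure_univ, mul_one]
  rw [← ENNReal.ofReal_add h0 (by linarith)]
  simp

lemma lintegral_bern_le {p z : ℝ} (h0 : 0 ≤ p) (h1 : p ≤ 1) (hz : 1 ≤ z) :
    ∫⁻ b, (if b = true then ENNReal.ofReal z else 1) ∂(bern p) ≤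
      ENNReal.ofReal (Real.exp ((z - 1) * p)) := by
  rw [bern, lintegral_add_measure, lintegral_smul_measure, lintegral_smul_measure,
    lintegral_dirac, lintegral_dirac]
  simp only [if_true, Bool.false_eq_true, if_false, smul_eq_mul, mul_one]
  rw [← ENNReal.ofReal_mul h0, ← ENNReal.ofReal_add (by positivity) (by linarith)]
  apply ENNReal.ofReal_le_ofReal
  have := Real.add_one_le_exp ((z - 1) * p)
  linarith

lemma lmarginal_finset_prod {ι : Type*} [Fintype ι] [DecidableEq ι] (μ : ι → Measure Bool)
    [∀ i, IsFiniteMeasure (μ i)] (g : Bool → ENNReal) (J : Finset ι) (ω : ι → Bool) :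
    (∫⋯∫⁻_J, (fun ω => ∏ i ∈ J, g (ω i)) ∂μ) ω = ∏ i ∈ J, ∫⁻ b, g b ∂(μ i) := by
  induction J using Finset.induction_on with
  | empty => simp
  | insert i s hi ih =>
    rw [lmarginal_insert' _ (measurable_of_finite _) hi, Finset.prod_insert hi]
    have hinner : (fun x : ι → Bool =>
        ∫⁻ b, ∏ j ∈ insert i s, g (Function.update x i b j) ∂(μ i)) =
        fun x => (∫⁻ b, g b ∂(μ i)) * ∏ j ∈ s, g (x j) := by
      funext x
      rw [← lintegral_mul_const _ (measurable_of_finite _)]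
      refine lintegral_congr fun b => ?_
      rw [Finset.prod_insert hi, Function.update_self]
      congr 1
      refine Finset.prod_congr rfl fun j hj => ?_
      rw [Function.update_of_ne (ne_of_mem_of_not_mem hj hi)]
    rw [hinner, ← ih]
    exact lintegral_const_mul _ (measurable_of_finite _)

variable {n : ℕ}

/-- The probability of the potential edge `e` in the hypergraph with edge probabilities
`p₂` and `p₃`. -/
noncomputable def edgeProb (p₂ p₃ : ℝ) (e : EdgeIdx n) : ℝ := if e.1.card = 2 then p₂ else p₃

lemma lmarginal_newEdges_le (P : Finset (Fin n)) (a : Fin n) {p₂ p₃ z : ℝ}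
    (h₂ : p₂ ∈ Set.Icc (0 : ℝ) 1) (h₃ : p₃ ∈ Set.Icc (0 : ℝ) 1) (hz : 1 ≤ z)
    (ω : EdgeIdx n → Bool) :
    (∫⋯∫⁻_newEdges P a,
      (fun ω => ∏ e ∈ newEdges P a, if ω e = true then ENNReal.ofReal z else 1)
        ∂(fun e => bern (edgeProb p₂ p₃ e))) ω ≤
      ENNReal.ofReal (Real.exp ((z - 1) * (n * p₂ + P.card * (n * p₃)))) := by
  rw [lmarginal_finset_prod _ fun b => if b = true then ENNReal.ofReal z else 1]
  have hp : ∀ e : EdgeIdx n, edgeProb p₂ p₃ e ∈ Set.Icc (0 : ℝ) 1 := fun e => by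
    unfold edgeProb
    split_ifs
    exacts [h₂, h₃]
  calc _ ≤ ∏ e ∈ newEdges P a, ENNReal.ofReal (Real.exp ((z - 1) * edgeProb p₂ p₃ e)) :=
        Finset.prod_le_prod' fun e _ => lintegral_bern_le (hp e).1 (hp e).2 hz
    _ = ENNReal.ofReal (Real.exp ((z - 1) * ∑ e ∈ newEdges P a, edgeProb p₂ p₃ e)) := by
        rw [← ENNReal.ofReal_prod_of_nonneg fun _ _ => (Real.exp_pos _).le, ← Real.exp_sum,
          Finset.mul_sum]
    _ ≤ _ := by
        have : 0 ≤ z - 1 := by linarith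
        gcongr
        exact sum_newEdges_le P a h₂.1 h₃.1

theorem lmarginal_survives_le {p₂ p₃ : ℝ} (h₂ : p₂ ∈ Set.Icc (0 : ℝ) 1)
    (h₃ : p₃ ∈ Set.Icc (0 : ℝ) 1) {z R : ℕ → ℝ} (hz : Antitone z) (hz1 : ∀ t, 1 ≤ z t)
    (hR : ∀ t, 0 ≤ R t) {M : ℕ} (hRM : 1 ≤ R M)
    (hstep : ∀ t < M, Real.exp ((z t - 1) * (n * p₂ + t * (n * p₃))) * R (t + 1) ≤ z t * R t)
    (k : ℕ) (P A : Finset (Fin n)) (hk : P.card + k = M) (hPA : Disjoint P A)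
    (ω : EdgeIdx n → Bool) :
    (∫⋯∫⁻_edgesBeyond P, ({ω | Survives M P A ω}.indicator 1)
      ∂(fun e => bern (edgeProb p₂ p₃ e))) ω ≤
      ENNReal.ofReal (z P.card ^ A.card * R P.card) := by
  have hp : ∀ e : EdgeIdx n, edgeProb p₂ p₃ e ∈ Set.Icc (0 : ℝ) 1 := fun e => by
    unfold edgeProb
    split_ifs
    exacts [h₂, h₃]
  have : ∀ e : EdgeIdx n, IsProbabilityMeasure (bern (edgeProb p₂ p₃ e)) :=
    fun e => isProbabilityMeasure_bern (hp e).1 (hp e).2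
  induction k generalizing P A ω with
  | zero =>
    have hone : (1 : ENNReal) ≤ ENNReal.ofReal (z P.card ^ A.card * R P.card) := by
      rw [ENNReal.one_le_ofReal, show P.card = M by omega]
      exact one_le_mul_of_one_le_of_one_le (one_le_pow₀ (hz1 M)) hRM
    refine le_trans ?_ hone
    refine (lmarginal_mono (g := 1) (Set.indicator_le_self' fun _ _ => zero_le) ω).trans ?_
    simp [lmarginal]
  | succ k ih =>
    obtain rfl | ⟨a, ha⟩ := A.eq_empty_or_nonempty
    · have hempty : {ω : EdgeIdx n → Bool | Survives M P ∅ ω} = ∅ :=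
        Set.eq_empty_of_forall_notMem fun ω => not_survives_empty (by omega) ω
      rw [hempty]
      simp [lmarginal]
    have haP : a ∉ P := Finset.disjoint_right.1 hPA ha
    have hcardP : (insert a P).card = P.card + 1 := Finset.card_insert_of_notMem haP
    have hsplit : edgesBeyond P = newEdges P a ∪ edgesBeyond (insert a P) :=
      (Finset.sdiff_union_of_subset (edgesBeyond_insert_subset P a)).symm
    have hdisj : Disjoint (newEdges P a) (edgesBeyond (insert a P)) := Finset.sdiff_disjoint
    have hz0 : ∀ t, 0 ≤ z t := fun t => zero_le_one.trans (hz1 t)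
    have hinner : ∀ ω : EdgeIdx n → Bool,
        (∫⋯∫⁻_edgesBeyond (insert a P), ({ω | Survives M P A ω}.indicator 1)
          ∂(fun e => bern (edgeProb p₂ p₃ e))) ω ≤
        ENNReal.ofReal (z P.card ^ (A.card - 1) * R (P.card + 1)) *
          ∏ e ∈ newEdges P a, if ω e = true then ENNReal.ofReal (z P.card) else 1 := by
      intro ω
      have hmono : (∫⋯∫⁻_edgesBeyond (insert a P), ({ω | Survives M P A ω}.indicator 1)
          ∂(fun e => bern (edgeProb p₂ p₃ e))) ω ≤
          (∫⋯∫⁻_edgesBeyond (insert a P),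
            ({ω' | Survives M (insert a P) (nextActive P A a ω) ω'}.indicator 1)
          ∂(fun e => bern (edgeProb p₂ p₃ e))) ω := by
        refine lintegral_mono fun y => ?_
        by_cases hS : Survives M P A (Function.updateFinset ω (edgesBeyond (insert a P)) y)
        · have hS' := hS.step (a := a)
          rw [nextActive_congr (ω' := ω) fun e he => by
            rw [Function.updateFinset, dif_neg (Finset.mem_sdiff.1 he).2]] at hS'
          rw [Set.indicator_of_mem (by exact hS), Set.indicator_of_mem (by exact hS')]
        · rw [Set.indicator_of_notMem (by exact hS)]
          exact zero_le
      refine (hmono.trans (ih (insert a P) (nextActive P A a ω) (by omega)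
        Finset.disjoint_sdiff ω)).trans ?_
      rw [Finset.prod_ite, Finset.prod_const, Finset.prod_const_one, mul_one,
        ← ENNReal.ofReal_pow (hz0 _),
        ← ENNReal.ofReal_mul (mul_nonneg (pow_nonneg (hz0 _) _) (hR _)), hcardP]
      apply ENNReal.ofReal_le_ofReal
      rw [mul_right_comm, ← pow_add]
      refine mul_le_mul_of_nonneg_right ?_ (hR _)
      calc z (P.card + 1) ^ (nextActive P A a ω).card
          ≤ z P.card ^ (nextActive P A a ω).card :=
            pow_le_pow_left₀ (hz0 _) (hz (Nat.le_succ _)) _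
        _ ≤ _ := pow_le_pow_right₀ (hz1 _) (card_nextActive_le ha ω)
    rw [hsplit, lmarginal_union _ _ (measurable_of_finite _) hdisj]
    calc _ ≤ (∫⋯∫⁻_newEdges P a, (fun ω =>
            ENNReal.ofReal (z P.card ^ (A.card - 1) * R (P.card + 1)) *
              ∏ e ∈ newEdges P a, if ω e = true then ENNReal.ofReal (z P.card) else 1)
          ∂(fun e => bern (edgeProb p₂ p₃ e))) ω := lmarginal_mono hinner ω
      _ = ENNReal.ofReal (z P.card ^ (A.card - 1) * R (P.card + 1)) *
          (∫⋯∫⁻_newEdges P a, (fun ω =>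
              ∏ e ∈ newEdges P a, if ω e = true then ENNReal.ofReal (z P.card) else 1)
          ∂(fun e => bern (edgeProb p₂ p₃ e))) ω :=
        lintegral_const_mul _ (measurable_of_finite _)
      _ ≤ ENNReal.ofReal (z P.card ^ (A.card - 1) * R (P.card + 1)) *
          ENNReal.ofReal (Real.exp ((z P.card - 1) * (n * p₂ + P.card * (n * p₃)))) := by
        gcongr
        exact lmarginal_newEdges_le P a h₂ h₃ (hz1 _) ω
      _ ≤ ENNReal.ofReal (z P.card ^ A.card * R P.card) := by
        rw [← ENNReal.ofReal_mul (mul_nonneg (pow_nonneg (hz0 _) _) (hR _))]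
        apply ENNReal.ofReal_le_ofReal
        have hA : z P.card ^ A.card = z P.card ^ (A.card - 1) * z P.card := by
          rw [← pow_succ, Nat.sub_add_cancel (Finset.card_pos.2 ⟨a, ha⟩)]
        rw [hA, mul_assoc, mul_assoc, mul_comm (R _)]
        exact mul_le_mul_of_nonneg_left (hstep _ (by omega)) (pow_nonneg (hz0 _) _)

theorem measure_survives_le {p₂ p₃ : ℝ} (h₂ : p₂ ∈ Set.Icc (0 : ℝ) 1)
    (h₃ : p₃ ∈ Set.Icc (0 : ℝ) 1) {z R : ℕ → ℝ} (hz : Antitone z) (hz1 : ∀ t, 1 ≤ z t)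
    (hR : ∀ t, 0 ≤ R t) {M : ℕ} (hRM : 1 ≤ R M)
    (hstep : ∀ t < M, Real.exp ((z t - 1) * (n * p₂ + t * (n * p₃))) * R (t + 1) ≤ z t * R t)
    (S : Finset (Fin n)) :
    Measure.pi (fun e : EdgeIdx n => bern (edgeProb p₂ p₃ e)) {ω | Survives M ∅ S ω} ≤
      ENNReal.ofReal (z 0 ^ S.card * R 0) := by
  have huniv : edgesBeyond (∅ : Finset (Fin n)) = Finset.univ := by
    ext e
    have := e.2
    simp only [mem_edgesBeyond, Finset.sdiff_empty, Finset.mem_univ, iff_true]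
    omega
  have h := lmarginal_survives_le h₂ h₃ hz hz1 hR hRM hstep M ∅ S (by simp)
    (Finset.disjoint_empty_left S) fun _ => true
  rw [huniv, lmarginal_univ, lintegral_indicator_one (Set.toFinite _).measurableSet] at h
  simpa using h

end Probability

section Analysis

/-- Tangent-line inequality for the concave function `x ↦ x² / 2 - x log x` on `(0, 1]`. -/
lemma sq_half_sub_mul_log_sub_le {x y : ℝ} (hx : 0 < x) (hxy : x ≤ y) (hy : y ≤ 1) :
    (y ^ 2 / 2 - y * Real.log y) - (x ^ 2 / 2 - x * Real.log x) ≤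
      (x - 1 - Real.log x) * (y - x) := by
  obtain rfl | hlt := hxy.eq_or_lt
  · simp
  have hderiv : ∀ t, 0 < t →
      HasDerivAt (fun t : ℝ => t ^ 2 / 2 - t * Real.log t) (t - 1 - Real.log t) t := by
    intro t ht
    refine (((hasDerivAt_pow 2 t).div_const 2).fun_sub
      (Real.hasDerivAt_mul_log ht.ne')).congr_deriv ?_
    push_cast
    ring
  obtain ⟨c, ⟨hxc, hcy⟩, hc⟩ := exists_hasDerivAt_eq_slope
    (fun t : ℝ => t ^ 2 / 2 - t * Real.log t) (fun t => t - 1 - Real.log t) hlt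
    (fun t ht => (hderiv t (hx.trans_le ht.1)).continuousAt.continuousWithinAt)
    (fun t ht => hderiv t (hx.trans ht.1))
  have hyx : 0 < y - x := sub_pos.2 hlt
  rw [eq_div_iff hyx.ne'] at hc
  rw [← hc]
  refine mul_le_mul_of_nonneg_right ?_ hyx.le
  have hc0 : 0 < c := hx.trans hxc
  have hlog := Real.one_sub_inv_le_log_of_pos (div_pos hc0 hx)
  rw [Real.log_div hc0.ne' hx.ne', inv_div] at hlog
  have hdiv : c - x ≤ 1 - x / c := by
    rw [one_sub_div hc0.ne', le_div_iff₀ hc0]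
    exact mul_le_of_le_one_right (by linarith) (hcy.le.trans hy)
  linarith

lemma prod_mul_exp_one_sub_le {ε d : ℝ} (hε0 : 0 < ε) (hε1 : ε < 1) (hd : 0 < d) {M : ℕ}
    (hM : ε ≤ M * d) :
    ∏ t ∈ Finset.range M, (min 1 (1 - ε + t * d) * Real.exp (1 - min 1 (1 - ε + t * d))) ≤
      Real.exp (-(1 / d) * (ε - ε ^ 2 / 2 + (1 - ε) * Real.log (1 - ε))) := by
  set lam : ℕ → ℝ := fun t => min 1 (1 - ε + t * d) with hlam
  have hpos : ∀ t, 0 < lam t := fun t => lt_min one_pos (by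
    have : 0 ≤ (t : ℝ) * d := by positivity
    linarith)
  have hle : ∀ t, lam t ≤ 1 := fun t => min_le_left _ _
  have hmono : ∀ t, lam t ≤ lam (t + 1) := fun t => by
    simp only [hlam]
    push_cast
    gcongr
    linarith
  have hdiff : ∀ t, lam (t + 1) - lam t ≤ d := fun t => by
    simp only [hlam]
    push_cast
    rcases min_cases (1 : ℝ) (1 - ε + t * d) with h | h <;>
    rcases min_cases (1 : ℝ) (1 - ε + (t + 1) * d) with h' | h' <;> linarith
  have hterm : ∀ t, lam t * Real.exp (1 - lam t) = Real.exp (-(lam t - 1 - Real.log (lam t))) := by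
    intro t
    rw [show -(lam t - 1 - Real.log (lam t)) = Real.log (lam t) + (1 - lam t) by ring,
      Real.exp_add, Real.exp_log (hpos t)]
  have hsum : (ε - ε ^ 2 / 2 + (1 - ε) * Real.log (1 - ε)) ≤
      (∑ t ∈ Finset.range M, (lam t - 1 - Real.log (lam t))) * d := by
    have h0 : lam 0 = 1 - ε := by simp [hlam, hε0.le]
    have h1 : lam M = 1 := min_eq_left (by linarith)
    have htel := Finset.sum_range_sub
      (fun t => lam t ^ 2 / 2 - lam t * Real.log (lam t)) M
    simp only [h0, h1] at htel
    calc _ = ∑ t ∈ Finset.range M, ((lam (t + 1) ^ 2 / 2 - lam (t + 1) * Real.log (lam (t + 1))) -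
          (lam t ^ 2 / 2 - lam t * Real.log (lam t))) := by
            rw [htel, Real.log_one]
            ring
      _ ≤ ∑ t ∈ Finset.range M, (lam t - 1 - Real.log (lam t)) * d := by
        refine Finset.sum_le_sum fun t _ => ?_
        refine (sq_half_sub_mul_log_sub_le (hpos t) (hmono t) (hle _)).trans ?_
        refine mul_le_mul_of_nonneg_left (hdiff t) ?_
        have := Real.log_le_sub_one_of_pos (hpos t)
        linarith
      _ = _ := (Finset.sum_mul _ _ _).symm
  rw [Finset.prod_congr rfl fun t _ => hterm t, ← Real.exp_sum, Real.exp_le_exp,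
    Finset.sum_neg_distrib, neg_mul, neg_le_neg_iff, one_div, inv_mul_le_iff₀ hd, mul_comm d]
  exact hsum

end Analysis

section Main

/-- Bound on the probability that at least `ε log n / r` vertices are reached from `S`. -/
theorem hypMeasure_survives_le {ε r : ℝ} (hε0 : 0 < ε) (hε1 : ε < 1) (hr : 0 < r) {n : ℕ}
    (hn : 3 ≤ n) (hrn : r ≤ n * Real.log n) (S : Finset (Fin n)) :
    hypMeasure n ε r {ω | Survives ⌈ε * Real.log n / r⌉₊ ∅ S ω} ≤
      ENNReal.ofReal ((1 - ε)⁻¹ ^ S.card * (n : ℝ) ^ Ier ε r) := by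
  have hn1 : (1 : ℝ) < n := by exact_mod_cast (by omega : 1 < n)
  have hn0 : (0 : ℝ) < n := one_pos.trans hn1
  have hlog : 0 < Real.log n := Real.log_pos hn1
  set M := ⌈ε * Real.log n / r⌉₊ with hMdef
  set d := r / Real.log n with hd
  have hd0 : 0 < d := div_pos hr hlog
  set lam : ℕ → ℝ := fun t => min 1 (1 - ε + t * d) with hlam
  have hpos : ∀ t, 0 < lam t := fun t => lt_min one_pos (by
    have : 0 ≤ (t : ℝ) * d := by positivity
    linarith)
  have hlt : ∀ t < M, lam t = 1 - ε + t * d := fun t ht => by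
    refine min_eq_right ?_
    have h := Nat.lt_ceil.1 ht
    rw [lt_div_iff₀ hr] at h
    have : (t : ℝ) * d ≤ ε := by
      rw [hd, ← mul_div_assoc, div_le_iff₀ hlog]
      exact h.le
    linarith
  have hMd : ε ≤ M * d := by
    have h := Nat.le_ceil (ε * Real.log n / r)
    rw [div_le_iff₀ hr] at h
    rwa [hd, ← mul_div_assoc, le_div_iff₀ hlog]
  set R : ℕ → ℝ := fun t => ∏ s ∈ Finset.Ico t M, (lam s * Real.exp (1 - lam s)) with hRdef
  have hbound := measure_survives_le (n := n) (p₂ := (1 - ε) / n) (p₃ := r / (n * Real.log n))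
    (z := fun t => (lam t)⁻¹) (R := R) (M := M)
    ⟨div_nonneg (by linarith) hn0.le, by rw [div_le_one hn0]; linarith⟩
    ⟨by positivity, (div_le_one (by positivity)).2 hrn⟩
    (fun s t hst => by
      refine inv_anti₀ (hpos s) ?_
      simp only [hlam]
      gcongr)
    (fun t => (one_le_inv₀ (hpos t)).2 (min_le_left _ _))
    (fun t => Finset.prod_nonneg fun s _ => (mul_pos (hpos s) (Real.exp_pos _)).le)
    (by simp [hRdef])
    (fun t ht => by
      have hmean : (n : ℝ) * ((1 - ε) / n) + t * (n * (r / (n * Real.log n))) = lam t := by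
        rw [hlt t ht, hd]
        field_simp
      have hRt : R t = lam t * Real.exp (1 - lam t) * R (t + 1) :=
        Finset.prod_eq_prod_Ico_succ_bot ht _
      rw [hmean, hRt, sub_mul, one_mul, inv_mul_cancel₀ (hpos t).ne', ← mul_assoc, ← mul_assoc,
        inv_mul_cancel₀ (hpos t).ne', one_mul])
    S
  refine hbound.trans (ENNReal.ofReal_le_ofReal ?_)
  have h0 : lam 0 = 1 - ε := by simp [hlam, hε0.le]
  rw [h0]
  refine mul_le_mul_of_nonneg_left ?_ (pow_nonneg (inv_nonneg.2 (by linarith)) _)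
  have hR0 : R 0 = ∏ t ∈ Finset.range M, (lam t * Real.exp (1 - lam t)) := by
    rw [Finset.range_eq_Ico]
  rw [hR0]
  refine (prod_mul_exp_one_sub_le hε0 hε1 hd0 hMd).trans_eq ?_
  rw [Real.rpow_def_of_pos hn0, Ier, hd]
  congr 1
  field_simp

lemma div_le_K0 {ε r : ℝ} (hε0 : 0 < ε) (hr : 0 < r) : ε / r ≤ K0 ε r :=
  (div_le_div_of_nonneg_right (by linarith) hr.le).trans (le_max_right _ _)

end Main

/-- Upper bound `n^{I_{ε,r}+o(1)}` on the probability that the propagation component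
of a given pair of distinct vertices has at least `K₀ ln n` vertices. -/
theorem prob_pair_component_large_upper (ε r : ℝ) (hε0 : 0 < ε) (hε1 : ε < 1)
    (hr : 0 < r) :
    ∀ δ > (0 : ℝ), ∃ N : ℕ, ∀ n ≥ N, ∀ v₁ v₂ : Fin n, v₁ ≠ v₂ →
      hypMeasure n ε r
          {ω | K0 ε r * Real.log n ≤ ((propComponent ω {v₁, v₂}).ncard : ℝ)} ≤
        ENNReal.ofReal ((n : ℝ) ^ (Ier ε r + δ)) := by
  intro δ hδ
  have htend : Tendsto (fun n : ℕ => (n : ℝ)) atTop atTop := tendsto_natCast_atTop_atTop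
  have hlarge : ∀ᶠ n : ℕ in atTop, r ≤ n * Real.log n ∧ (1 - ε)⁻¹ ^ 2 ≤ (n : ℝ) ^ δ ∧ 3 ≤ n :=
    ((htend.atTop_mul_atTop₀ (Real.tendsto_log_atTop.comp htend)).eventually_ge_atTop r).and
      ((((tendsto_rpow_atTop hδ).comp htend).eventually_ge_atTop _).and (eventually_ge_atTop 3))
  obtain ⟨N, hN⟩ := eventually_atTop.1 hlarge
  refine ⟨N, fun n hn v₁ v₂ hv => ?_⟩
  obtain ⟨hrn, hδn, hn3⟩ := hN n hn
  have hn1 : (1 : ℝ) < n := by exact_mod_cast (by omega : 1 < n)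
  have hlog : 0 < Real.log n := Real.log_pos hn1
  have hsub : {ω : EdgeIdx n → Bool |
      K0 ε r * Real.log n ≤ ((propComponent ω {v₁, v₂}).ncard : ℝ)} ⊆
      {ω | Survives ⌈ε * Real.log n / r⌉₊ ∅ {v₁, v₂} ω} := by
    intro ω hω
    refine survives_of_le_ncard_propComponent (Nat.ceil_le.2 (le_trans ?_ hω))
    rw [mul_div_right_comm]
    exact mul_le_mul_of_nonneg_right (div_le_K0 hε0 hr) hlog.le
  refine (measure_mono hsub).trans
    ((hypMeasure_survives_le hε0 hε1 hr hn3 hrn _).trans (ENNReal.ofReal_le_ofReal ?_))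
  rw [Finset.card_pair hv, Real.rpow_add (one_pos.trans hn1), mul_comm]
  exact mul_le_mul_of_nonneg_left hδn (Real.rpow_nonneg (by positivity) _)
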